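/- arXiv:2501.16244 — 4 statements merged into one kernel-verified Lean document; each statement's English description precedes it below -/
import Mathlib

section
/- For every compact set D ⊂ (0,∞) × ℝ there exists a constant C > 0 such that |q(a;b)| ≤ C·η(a|b) for all a, b ∈ D. -/
/-- The entropy of the isothermal p-system: `η(τ,v) = v²/2 - ln τ`. -/
noncomputable def eta (u : ℝ × ℝ) : ℝ := u.2 ^ 2 / 2 - Real.log u.1

/-- The relative entropy `η(a|b) = η(a) - η(b) - ∇η(b)·(a-b)`, where
`∇η(τ,v) = (-1/τ, v)`. -/
noncomputable def relEta (a b : ℝ × ℝ) : ℝ :=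
  eta a - eta b - ((-1 / b.1) * (a.1 - b.1) + b.2 * (a.2 - b.2))

/-- The entropy flux `q(τ,v) = v/τ`. -/
noncomputable def qflux (u : ℝ × ℝ) : ℝ := u.2 / u.1

/-- The flux of the p-system: `f(τ,v) = (-v, 1/τ)`. -/
noncomputable def pflux (u : ℝ × ℝ) : ℝ × ℝ := (-u.2, 1 / u.1)

/-- The relative entropy flux `q(a;b) = q(a) - q(b) - ∇η(b)·(f(a) - f(b))`. -/
noncomputable def relQ (a b : ℝ × ℝ) : ℝ :=
  qflux a - qflux b -
    ((-1 / b.1) * ((pflux a).1 - (pflux b).1) + b.2 * ((pflux a).2 - (pflux b).2))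

theorem sq_sub_one_div_le_sub_one_sub_log {x : ℝ} (hx : 0 < x) :
    (x - 1) ^ 2 / (2 * (x + 1)) ≤ x - 1 - Real.log x := by
  obtain ⟨y, hy, rfl⟩ : ∃ y : ℝ, 0 < y ∧ y ^ 2 = x :=
    ⟨√x, Real.sqrt_pos.2 hx, Real.sq_sqrt hx.le⟩
  have hlog : Real.log (y ^ 2) ≤ 2 * (y - 1) := by
    rw [Real.log_pow]
    push_cast
    linarith [Real.log_le_sub_one_of_pos hy]
  have hsq : (y ^ 2 - 1) ^ 2 / (2 * (y ^ 2 + 1)) ≤ (y - 1) ^ 2 := by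
    rw [div_le_iff₀ (by positivity)]
    nlinarith [sq_nonneg ((y - 1) ^ 2)]
  linarith

theorem relQ_eq {a b : ℝ × ℝ} (ha : 0 < a.1) (hb : 0 < b.1) :
    relQ a b = -((a.2 - b.2) * (a.1 - b.1) * (1 / a.1 * (1 / b.1))) := by
  simp only [relQ, qflux, pflux]
  field_simp
  ring

theorem relEta_ge {a b : ℝ × ℝ} (ha : 0 < a.1) (hb : 0 < b.1) :
    (a.2 - b.2) ^ 2 / 2 + (a.1 - b.1) ^ 2 / (2 * b.1 * (a.1 + b.1)) ≤ relEta a b := by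
  have h := sq_sub_one_div_le_sub_one_sub_log (div_pos ha hb)
  rw [Real.log_div ha.ne' hb.ne'] at h
  have h1 : (a.1 / b.1 - 1) ^ 2 / (2 * (a.1 / b.1 + 1)) =
      (a.1 - b.1) ^ 2 / (2 * b.1 * (a.1 + b.1)) := by
    field_simp
  have h2 : -1 / b.1 * (a.1 - b.1) = 1 - a.1 / b.1 := by
    field_simp
    ring
  rw [h1] at h
  simp only [relEta, eta, h2]
  linarith

/-- On any compact subset `D` of `(0,∞) × ℝ`, the relative entropy flux is
controlled by the relative entropy: `|q(a;b)| ≤ C·η(a|b)`. -/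
theorem relQ_le_relEta (D : Set (ℝ × ℝ)) (hD : IsCompact D)
    (hD0 : D ⊆ Set.Ioi (0 : ℝ) ×ˢ (Set.univ : Set ℝ)) :
    ∃ C : ℝ, 0 < C ∧ ∀ a ∈ D, ∀ b ∈ D, |relQ a b| ≤ C * relEta a b := by
  have hpos : ∀ a ∈ D, 0 < a.1 := fun a ha => (hD0 ha).1
  obtain ⟨M₀, hM₀⟩ := hD.bddAbove_image (f := fun a => a.1) continuousOn_fst
  obtain ⟨N₀, hN₀⟩ := hD.bddAbove_image (f := fun a => 1 / a.1)
    (continuousOn_const.div continuousOn_fst fun a ha => (hpos a ha).ne')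
  obtain ⟨M, hM, hM1⟩ : ∃ M : ℝ, (∀ a ∈ D, a.1 ≤ M) ∧ 0 < M :=
    ⟨max M₀ 1, fun a ha => (hM₀ ⟨a, ha, rfl⟩).trans (le_max_left _ _), by positivity⟩
  obtain ⟨N, hN, hN1⟩ : ∃ N : ℝ, (∀ a ∈ D, 1 / a.1 ≤ N) ∧ 0 < N :=
    ⟨max N₀ 1, fun a ha => (hN₀ ⟨a, ha, rfl⟩).trans (le_max_left _ _), by positivity⟩
  refine ⟨2 * M * N ^ 2, by positivity, fun a ha b hb => ?_⟩
  have ha0 := hpos a ha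
  have hb0 := hpos b hb
  have hden : 2 * b.1 * (a.1 + b.1) ≤ 4 * M ^ 2 := by
    nlinarith [mul_le_mul (hM b hb) (add_le_add (hM a ha) (hM b hb)) (by positivity) hM1.le]
  have hinv : 1 / a.1 * (1 / b.1) ≤ N ^ 2 := by
    rw [sq]
    exact mul_le_mul (hN a ha) (hN b hb) (by positivity) hN1.le
  have hyoung : |(a.2 - b.2) * (a.1 - b.1)| ≤
      2 * M * ((a.2 - b.2) ^ 2 / 2 + (a.1 - b.1) ^ 2 / (4 * M ^ 2)) := by
    have e : 2 * M * ((a.2 - b.2) ^ 2 / 2 + (a.1 - b.1) ^ 2 / (4 * M ^ 2)) =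
        (2 * M ^ 2 * (a.2 - b.2) ^ 2 + (a.1 - b.1) ^ 2) / (2 * M) := by
      field_simp
      ring
    rw [e, le_div_iff₀ (by positivity), abs_mul, ← sq_abs (a.2 - b.2), ← sq_abs (a.1 - b.1)]
    nlinarith [sq_nonneg (M * |a.2 - b.2| - |a.1 - b.1|), sq_nonneg (M * |a.2 - b.2|)]
  calc |relQ a b| = |(a.2 - b.2) * (a.1 - b.1)| * (1 / a.1 * (1 / b.1)) := by
        rw [relQ_eq ha0 hb0, abs_neg, abs_mul, abs_of_pos (a := 1 / a.1 * (1 / b.1))]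
        positivity
    _ ≤ 2 * M * ((a.2 - b.2) ^ 2 / 2 + (a.1 - b.1) ^ 2 / (4 * M ^ 2)) * N ^ 2 := by
        gcongr
    _ = 2 * M * N ^ 2 * ((a.2 - b.2) ^ 2 / 2 + (a.1 - b.1) ^ 2 / (4 * M ^ 2)) := by ring
    _ ≤ 2 * M * N ^ 2 *
        ((a.2 - b.2) ^ 2 / 2 + (a.1 - b.1) ^ 2 / (2 * b.1 * (a.1 + b.1))) := by
        gcongr
    _ ≤ 2 * M * N ^ 2 * relEta a b := by
        gcongr
        exact relEta_ge ha0 hb0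
end

section
/- For all real numbers w_l, v_l, w_r, v_r there exists a unique real number w_m such that v_l − v_r = W(w_m − w_l) + W(w_m − w_r). -/
/-- `W(s) = s` for `s ≤ 0` and `W(s) = 2 sinh(s/2)` for `s ≥ 0`. -/
noncomputable def W (s : ℝ) : ℝ := if s ≤ 0 then s else 2 * Real.sinh (s / 2)

theorem W_strictMono : StrictMono W := by
  intro a b hab
  unfold W
  split_ifs with ha hb hb
  · exact hab
  · have : 0 < Real.sinh (b / 2) := Real.sinh_pos_iff.2 (by linarith)
    linarith
  · linarith
  · have : Real.sinh (a / 2) < Real.sinh (b / 2) := Real.sinh_lt_sinh.2 (by linarith)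
    linarith

theorem continuous_W : Continuous W := by
  refine Continuous.if_le continuous_id (by fun_prop) continuous_id continuous_const ?_
  rintro x rfl
  simp

theorem le_W (s : ℝ) : s ≤ W s := by
  unfold W
  split_ifs with hs
  · exact le_rfl
  · have : s / 2 ≤ Real.sinh (s / 2) := Real.self_le_sinh_iff.2 (by linarith)
    linarith

theorem W_of_nonpos {s : ℝ} (hs : s ≤ 0) : W s = s := if_pos hs

theorem tendsto_W_atTop : Filter.Tendsto W Filter.atTop Filter.atTop :=
  Filter.tendsto_atTop_mono le_W Filter.tendsto_id

theorem tendsto_W_atBot : Filter.Tendsto W Filter.atBot Filter.atBot :=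
  Filter.tendsto_id.congr'
    ((Filter.eventually_le_atBot 0).mono fun _ hs => (W_of_nonpos hs).symm)

/-- For all reals `w_l, v_l, w_r, v_r` there is a unique `w_m` with
`v_l - v_r = W(w_m - w_l) + W(w_m - w_r)`. -/
theorem exists_unique_intermediate_state (wl vl wr vr : ℝ) :
    ∃! wm : ℝ, vl - vr = W (wm - wl) + W (wm - wr) := by
  have hmono : StrictMono fun x => W (x - wl) + W (x - wr) := fun a b hab =>
    add_lt_add (W_strictMono (sub_lt_sub_right hab wl)) (W_strictMono (sub_lt_sub_right hab wr))
  have hcont : Continuous fun x => W (x - wl) + W (x - wr) :=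
    (continuous_W.comp (continuous_sub_right wl)).add (continuous_W.comp (continuous_sub_right wr))
  have htop (c : ℝ) : Filter.Tendsto (fun x => W (x - c)) Filter.atTop Filter.atTop :=
    tendsto_W_atTop.comp (Filter.tendsto_atTop_add_const_right _ (-c) Filter.tendsto_id)
  have hbot (c : ℝ) : Filter.Tendsto (fun x => W (x - c)) Filter.atBot Filter.atBot :=
    tendsto_W_atBot.comp (Filter.tendsto_atBot_add_const_right _ (-c) Filter.tendsto_id)
  obtain ⟨x, hx⟩ := hcont.surjective ((htop wl).atTop_add_atTop (htop wr))
    ((hbot wl).atBot_add_atBot (hbot wr)) (vl - vr)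
  exact ⟨x, hx.symm, fun y hy => hmono.injective (hy.symm.trans hx.symm)⟩
end

section
/- For states u = (w,v) and u' = (w',v') in ℝ², let m(u,u') denote the unique real number satisfying v − v' = W(m − w) + W(m − w'), and define D(u,u') = |w − m(u,u')| + |m(u,u') − w'|. Then for any three states u₁, u₂, u₃ ∈ ℝ² one has D(u₁,u₃) ≤ D(u₁,u₂) + D(u₂,u₃). -/
/-- Given an intermediate-state map `m`, the quantity
`D(u,u') = |w - m(u,u')| + |m(u,u') - w'|` measuring the total variation in `w` of the
solution of the Riemann problem between `u` and `u'`. -/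
noncomputable def Dvar (m : ℝ × ℝ → ℝ × ℝ → ℝ) (u u' : ℝ × ℝ) : ℝ :=
  |u.1 - m u u'| + |m u u' - u'.1|

theorem W_of_nonneg {s : ℝ} (hs : 0 ≤ s) : W s = 2 * Real.sinh (s / 2) := by
  rcases hs.eq_or_lt with rfl | hs
  · simp [W]
  · exact if_neg (not_le.mpr hs)

theorem neg_abs_le_W (s : ℝ) : -|s| ≤ W s := by
  rcases le_total s 0 with hs | hs
  · rw [W_of_nonpos hs, abs_of_nonpos hs, neg_neg]
  · rw [W_of_nonneg hs, abs_of_nonneg hs]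
    have := Real.sinh_nonneg_iff.mpr (show 0 ≤ s / 2 by linarith)
    linarith

theorem W_add_le_of_nonneg {x y : ℝ} (hx : 0 ≤ x) (hy : 0 ≤ y) : W x + W y ≤ W (x + y) := by
  rw [W_of_nonneg hx, W_of_nonneg hy, W_of_nonneg (add_nonneg hx hy), add_div, Real.sinh_add]
  have hx' := Real.sinh_nonneg_iff.mpr (show 0 ≤ x / 2 by linarith)
  have hy' := Real.sinh_nonneg_iff.mpr (show 0 ≤ y / 2 by linarith)
  nlinarith [mul_nonneg hx' (sub_nonneg.mpr (Real.one_le_cosh (y / 2))),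
    mul_nonneg hy' (sub_nonneg.mpr (Real.one_le_cosh (x / 2)))]

theorem W_add_W_le {x y z : ℝ} (h : max x 0 + max y 0 ≤ z) : W x + W y ≤ W z :=
  (add_le_add (W_strictMono.monotone (le_max_left x 0))
    (W_strictMono.monotone (le_max_left y 0))).trans
    ((W_add_le_of_nonneg (le_max_right x 0) (le_max_right y 0)).trans (W_strictMono.monotone h))

theorem abs_add_abs_le_of_W_eq {X Y x₁ x₂ y₁ y₂ : ℝ} (hd : Y - X = x₂ - x₁ + (y₂ - y₁))
    (hW : W X + W Y = W x₁ + W x₂ + (W y₁ + W y₂)) :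
    |X| + |Y| ≤ |x₁| + |x₂| + (|y₁| + |y₂|) := by
  have habs (x : ℝ) : |x| = max x 0 + max (-x) 0 := by
    rcases le_total x 0 with h | h
    · rw [abs_of_nonpos h, max_eq_right h, max_eq_left (by linarith), zero_add]
    · rw [abs_of_nonneg h, max_eq_left h, max_eq_right (by linarith), add_zero]
  have hsub (x : ℝ) : x = max x 0 - max (-x) 0 := by
    rcases le_total x 0 with h | h
    · rw [max_eq_right h, max_eq_left (by linarith)]; ring
    · rw [max_eq_left h, max_eq_right (by linarith)]; ring
  have hneg (x : ℝ) : 0 ≤ max (-x) 0 := le_max_right _ _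
  -- `P + N` is the total variation on the right and `P - N = Y - X`.
  set P := max x₂ 0 + max y₂ 0 + max (-x₁) 0 + max (-y₁) 0
  set N := max x₁ 0 + max y₁ 0 + max (-x₂) 0 + max (-y₂) 0
  have hS : |x₁| + |x₂| + (|y₁| + |y₂|) = P + N := by
    rw [habs x₁, habs x₂, habs y₁, habs y₂]; ring
  have hD : Y - X = P - N := by
    linarith [hsub x₁, hsub x₂, hsub y₁, hsub y₂]
  have hWP : W x₂ + W y₂ ≤ W P := W_add_W_le (by linarith [hneg x₁, hneg y₁])
  have hWN : W x₁ + W y₁ ≤ W N := W_add_W_le (by linarith [hneg x₂, hneg y₂])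
  have hsum : X + Y ≤ P + N := by
    by_contra! h
    have hX : W N < W X := W_strictMono (by linarith)
    have hY : W P < W Y := W_strictMono (by linarith)
    linarith
  have hP0 : 0 ≤ P := by positivity
  have hN0 : 0 ≤ N := by positivity
  rcases le_total X 0 with hX | hX <;> rcases le_total Y 0 with hY | hY
  · rw [abs_of_nonpos hX, abs_of_nonpos hY]
    rw [W_of_nonpos hX, W_of_nonpos hY] at hW
    linarith [neg_abs_le_W x₁, neg_abs_le_W x₂, neg_abs_le_W y₁, neg_abs_le_W y₂]
  · rw [abs_of_nonpos hX, abs_of_nonneg hY]; linarith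
  · rw [abs_of_nonneg hX, abs_of_nonpos hY]; linarith
  · rw [abs_of_nonneg hX, abs_of_nonneg hY]; linarith

/-- The triangle inequality `D(u₁,u₃) ≤ D(u₁,u₂) + D(u₂,u₃)` for the
intermediate-state total variation: `w` is a TVD field for the isothermal p-system. -/
theorem Dvar_triangle (m : ℝ × ℝ → ℝ × ℝ → ℝ)
    (hm : ∀ u u' : ℝ × ℝ, u.2 - u'.2 = W (m u u' - u.1) + W (m u u' - u'.1))
    (u₁ u₂ u₃ : ℝ × ℝ) :
    Dvar m u₁ u₃ ≤ Dvar m u₁ u₂ + Dvar m u₂ u₃ := by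
  unfold Dvar
  rw [abs_sub_comm u₁.1 (m u₁ u₃), abs_sub_comm u₁.1 (m u₁ u₂), abs_sub_comm u₂.1 (m u₂ u₃)]
  exact abs_add_abs_le_of_W_eq (by ring) (by linarith [hm u₁ u₂, hm u₂ u₃, hm u₁ u₃])
end

section
/- Let f = (τ⁰, v⁰) : ℝ → ℝ² be a function of bounded variation with total variation V over ℝ, satisfying |f(x)| ≤ M for all x and τ⁰(x) ≥ β for all x, where M, β > 0. Then for every ε > 0 and R > 0 there exists a step function g = (τ_g, v_g) : ℝ → ℝ² (piecewise constant with finitely many pieces) such that: the total variation of g over ℝ is at most 2V; |g(x)| ≤ M for all x; τ_g(x) ≥ β for all x; and ‖g − f‖_{L²([−R,R])} ≤ ε. -/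
open MeasureTheory

/-- A step function `ℝ → ℝ²`: there are finitely many breakpoints such that `g` takes the
same value at any two points lying on the same side of every breakpoint. -/
def IsStepFunction (g : ℝ → EuclideanSpace ℝ (Fin 2)) : Prop :=
  ∃ (N : ℕ) (x : Fin N → ℝ), ∀ y z : ℝ,
    (∀ i, (y < x i ↔ z < x i) ∧ (x i < y ↔ x i < z)) → g y = g z

/-- The set of partial-variation sums of `g : ℝ → ℝ²` along finite increasing sequences of
points; its supremum is the total variation of `g` over `ℝ`. -/
def tvSums (g : ℝ → EuclideanSpace ℝ (Fin 2)) : Set ℝ :=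
  {s : ℝ | ∃ (N : ℕ) (x : Fin (N + 1) → ℝ), StrictMono x ∧
    s = ∑ i : Fin N, ‖g (x i.succ) - g (x i.castSucc)‖}

/-- The total variation of `g` over `ℝ` is at most `M`. -/
def TVBoundedBy (g : ℝ → EuclideanSpace ℝ (Fin 2)) (M : ℝ) : Prop :=
  ∀ s ∈ tvSums g, s ≤ M

open Filter Topology

/-- Rounding down to the grid of mesh `1 / (n + 1)`, truncated to finitely many grid points. -/
noncomputable def gridIndex (n : ℕ) (x : ℝ) : ℤ :=
  max (-((n + 1) ^ 2 : ℤ)) (min ⌊((n : ℝ) + 1) * x⌋ ((n + 1) ^ 2 : ℤ))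

/-- The truncated grid point below `x`. -/
noncomputable def gridPoint (n : ℕ) (x : ℝ) : ℝ :=
  (gridIndex n x : ℝ) / ((n : ℝ) + 1)

lemma gridIndex_monotone (n : ℕ) : Monotone (gridIndex n) := by
  intro x y hxy
  have : ⌊((n : ℝ) + 1) * x⌋ ≤ ⌊((n : ℝ) + 1) * y⌋ := by gcongr
  exact max_le_max le_rfl (min_le_min this le_rfl)

lemma gridPoint_monotone (n : ℕ) : Monotone (gridPoint n) := by
  intro x y hxy
  have := gridIndex_monotone n hxy
  unfold gridPoint
  gcongr

lemma measurable_gridIndex (n : ℕ) : Measurable (gridIndex n) :=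
  (gridIndex_monotone n).measurable

lemma measurable_comp_gridPoint {E : Type*} [MeasurableSpace E] (f : ℝ → E) (n : ℕ) :
    Measurable (f ∘ gridPoint n) :=
  (measurable_from_top (f := fun k : ℤ => f ((k : ℝ) / ((n : ℝ) + 1)))).comp
    (measurable_gridIndex n)

lemma gridPoint_tendsto (x : ℝ) : Tendsto (fun n => gridPoint n x) atTop (𝓝 x) := by
  obtain ⟨N, hN⟩ := exists_nat_ge |x|
  have h_lower : Tendsto (fun n : ℕ => x - 1 / ((n : ℝ) + 1)) atTop (𝓝 x) := by
    simpa using tendsto_const_nhds.sub (tendsto_one_div_add_atTop_nhds_zero_nat (𝕜 := ℝ))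
  refine tendsto_of_tendsto_of_tendsto_of_le_of_le' h_lower tendsto_const_nhds ?_ ?_
  all_goals
    filter_upwards [eventually_ge_atTop N] with n hn
    have hn' : (N : ℝ) ≤ n := by exact_mod_cast hn
    have hpos : (0 : ℝ) < (n : ℝ) + 1 := by positivity
    have hx := abs_le.1 (hN.trans hn')
    have h_idx : gridIndex n x = ⌊((n : ℝ) + 1) * x⌋ := by
      have h_le : ⌊((n : ℝ) + 1) * x⌋ ≤ ((n + 1) ^ 2 : ℤ) := by
        refine Int.floor_le_iff.2 ?_
        push_cast
        nlinarith
      have h_ge : -((n + 1) ^ 2 : ℤ) ≤ ⌊((n : ℝ) + 1) * x⌋ := by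
        refine Int.le_floor.2 ?_
        push_cast
        nlinarith
      rw [gridIndex, min_eq_left h_le, max_eq_right h_ge]
    rw [gridPoint, h_idx]
  · rw [le_div_iff₀ hpos, sub_mul, one_div, inv_mul_cancel₀ hpos.ne', mul_comm x]
    exact (Int.sub_one_lt_floor _).le
  · rw [div_le_iff₀ hpos, mul_comm x]
    exact Int.floor_le _

lemma isStepFunction_comp_gridPoint (f : ℝ → EuclideanSpace ℝ (Fin 2)) (n : ℕ) :
    IsStepFunction (f ∘ gridPoint n) := by
  refine ⟨2 * (n + 1) ^ 2 + 1, fun i => ((i : ℝ) - ((n : ℝ) + 1) ^ 2) / ((n : ℝ) + 1), ?_⟩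
  have hpos : (0 : ℝ) < (n : ℝ) + 1 := by positivity
  suffices h : ∀ y z : ℝ, (∀ i : Fin (2 * (n + 1) ^ 2 + 1),
      ((i : ℝ) - ((n : ℝ) + 1) ^ 2) / ((n : ℝ) + 1) ≤ y →
      ((i : ℝ) - ((n : ℝ) + 1) ^ 2) / ((n : ℝ) + 1) ≤ z) → gridIndex n y ≤ gridIndex n z by
    intro y z hyz
    have h_eq : gridIndex n y = gridIndex n z := by
      refine le_antisymm (h y z fun i hi => ?_) (h z y fun i hi => ?_)
      · exact not_lt.1 fun hlt => not_lt.2 hi ((hyz i).1.2 hlt)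
      · exact not_lt.1 fun hlt => not_lt.2 hi ((hyz i).1.1 hlt)
    simp only [Function.comp_apply, gridPoint, h_eq]
  intro y z h
  set k := gridIndex n y with hk
  have h_low : -((n + 1) ^ 2 : ℤ) ≤ k := le_max_left _ _
  have h_high : k ≤ ((n + 1) ^ 2 : ℤ) :=
    max_le (by linarith [sq_nonneg ((n : ℤ) + 1)]) (min_le_right _ _)
  rcases h_low.eq_or_lt with h_eq | h_lt
  · rw [← h_eq]
    exact le_max_left _ _
  have hky : k ≤ ⌊((n : ℝ) + 1) * y⌋ := by
    rcases le_max_iff.1 hk.le with h' | h'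
    · exact absurd h' (not_le.2 h_lt)
    · exact h'.trans (min_le_left _ _)
  refine le_max_of_le_right (le_min ?_ h_high)
  obtain ⟨j, hj⟩ := Int.eq_ofNat_of_zero_le (show 0 ≤ k + ((n + 1) ^ 2 : ℤ) by linarith)
  have hj_lt : j < 2 * (n + 1) ^ 2 + 1 := by
    zify
    linarith
  have hjk : (j : ℝ) - ((n : ℝ) + 1) ^ 2 = k := by
    have : (k : ℝ) + ((n : ℝ) + 1) ^ 2 = j := by exact_mod_cast hj
    linarith
  have hi := h ⟨j, hj_lt⟩
  simp only [hjk, div_le_iff₀ hpos, mul_comm _ ((n : ℝ) + 1)] at hi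
  exact Int.le_floor.2 (hi (Int.le_floor.1 hky))

lemma eVariationOn_univ_le_of_TVBoundedBy {f : ℝ → EuclideanSpace ℝ (Fin 2)} {V : ℝ}
    (h : TVBoundedBy f V) : eVariationOn f Set.univ ≤ ENNReal.ofReal V := by
  rw [eVariationOn.eVariationOn_eq_strictMonoOn]
  refine iSup_le ?_
  rintro ⟨n, u, hu, -⟩
  have h_sum := h _ ⟨n, fun i => u i, fun i j hij => hu (Nat.lt_succ_iff.1 i.2)
    (Nat.lt_succ_iff.1 j.2) hij, rfl⟩
  simp only [edist_dist, dist_eq_norm]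
  rw [← ENNReal.ofReal_sum_of_nonneg fun _ _ => norm_nonneg _]
  refine ENNReal.ofReal_le_ofReal (le_trans (le_of_eq ?_) h_sum)
  rw [Finset.sum_range]
  simp

lemma TVBoundedBy_of_eVariationOn_univ_le {f : ℝ → EuclideanSpace ℝ (Fin 2)} {V : ℝ}
    (hV : 0 ≤ V) (h : eVariationOn f Set.univ ≤ ENNReal.ofReal V) : TVBoundedBy f V := by
  rintro s ⟨N, x, hx, rfl⟩
  let u : ℕ → ℝ := fun i => x (Fin.ofNat (N + 1) (min i N))
  have hu : Monotone u := by
    intro i j hij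
    refine hx.monotone ?_
    rw [Fin.le_def]
    simp only [Fin.val_ofNat]
    rw [Nat.mod_eq_of_lt (by omega), Nat.mod_eq_of_lt (by omega)]
    omega
  have h_sum := (eVariationOn.sum_le (f := f) (n := N) hu fun _ => Set.mem_univ _).trans h
  simp only [edist_dist, dist_eq_norm] at h_sum
  rw [← ENNReal.ofReal_sum_of_nonneg fun _ _ => norm_nonneg _,
    ENNReal.ofReal_le_ofReal_iff hV, Finset.sum_range] at h_sum
  refine le_trans (le_of_eq (Finset.sum_congr rfl fun i _ => ?_)) h_sum
  have h_succ : Fin.ofNat (N + 1) (min (i + 1 : ℕ) N) = i.succ := by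
    ext
    simp only [Fin.val_ofNat, Fin.val_succ]
    rw [Nat.mod_eq_of_lt (by omega)]
    omega
  have h_cast : Fin.ofNat (N + 1) (min (i : ℕ) N) = i.castSucc := by
    ext
    simp only [Fin.val_ofNat, Fin.val_castSucc]
    rw [Nat.mod_eq_of_lt (by omega)]
    omega
  simp only [u, h_succ, h_cast]

lemma tendsto_eLpNorm_comp_gridPoint_sub {f : ℝ → EuclideanSpace ℝ (Fin 2)} {M : ℝ}
    (hf : BoundedVariationOn f Set.univ) (hbd : ∀ x, ‖f x‖ ≤ M) {p : ENNReal} (hp : 1 ≤ p)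
    (hp' : p ≠ ⊤) (μ : Measure ℝ) [IsFiniteMeasure μ] (hμ : μ ≪ volume) :
    Tendsto (fun n => eLpNorm (f ∘ gridPoint n - f) p μ) atTop (𝓝 0) := by
  have h_lim : ∀ᵐ x ∂μ, Tendsto (fun n => (f ∘ gridPoint n) x) atTop (𝓝 (f x)) := by
    refine hμ.ae_le ?_
    filter_upwards [hf.locallyBoundedVariationOn.ae_differentiableAt] with x hx
    exact hx.continuousAt.tendsto.comp (gridPoint_tendsto x)
  have h_meas : ∀ n, Measurable (f ∘ gridPoint n) := measurable_comp_gridPoint f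
  have hf_meas : AEMeasurable f μ :=
    aemeasurable_of_tendsto_metrizable_ae' (fun n => (h_meas n).aemeasurable) h_lim
  refine tendsto_Lp_finite_of_tendsto_ae hp hp' (fun n => (h_meas n).aestronglyMeasurable)
    (MemLp.of_bound hf_meas.aestronglyMeasurable M (ae_of_all _ hbd)) ?_ h_lim
  refine unifIntegrable_of hp hp' (fun n => (h_meas n).aestronglyMeasurable) fun ε _ =>
    ⟨(M + 1).toNNReal, fun n => ?_⟩
  have h_empty : {x | (M + 1).toNNReal ≤ ‖(f ∘ gridPoint n) x‖₊} = ∅ := by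
    refine Set.eq_empty_of_forall_notMem fun x hx => ?_
    have h_le : M + 1 ≤ ‖f (gridPoint n x)‖ := Real.toNNReal_le_iff_le_coe.1 hx
    linarith [hbd (gridPoint n x)]
  rw [h_empty]
  simp

/-- A BV function `f = (τ⁰, v⁰)` with total variation `V`, bounded by
`M`, with `τ⁰ ≥ β > 0`, can be approximated in `L²([-R,R])` by step functions with total
variation at most `2V`, the same `L^∞` bound, and the same lower bound on `τ`. -/
theorem step_function_approximation (f : ℝ → EuclideanSpace ℝ (Fin 2))
    (V M β : ℝ) (hM : 0 < M) (hβ : 0 < β)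
    (hTV : IsLUB (tvSums f) V)
    (hbd : ∀ x : ℝ, ‖f x‖ ≤ M)
    (hτ : ∀ x : ℝ, β ≤ f x 0) :
    ∀ ε R : ℝ, 0 < ε → 0 < R →
      ∃ g : ℝ → EuclideanSpace ℝ (Fin 2),
        IsStepFunction g ∧
        TVBoundedBy g (2 * V) ∧
        (∀ x : ℝ, ‖g x‖ ≤ M) ∧
        (∀ x : ℝ, β ≤ g x 0) ∧
        eLpNorm (fun x : ℝ => g x - f x) 2 (volume.restrict (Set.Icc (-R) R)) ≤
          ENNReal.ofReal ε := by
  intro ε R hε _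
  have hV : 0 ≤ V := hTV.1 ⟨0, fun _ => 0, fun i j hij => by lia, by simp⟩
  have h_var : eVariationOn f Set.univ ≤ ENNReal.ofReal V :=
    eVariationOn_univ_le_of_TVBoundedBy fun s hs => hTV.1 hs
  have hf : BoundedVariationOn f Set.univ := ne_top_of_le_ne_top ENNReal.ofReal_ne_top h_var
  obtain ⟨n, hn⟩ := ((tendsto_eLpNorm_comp_gridPoint_sub hf hbd one_le_two ENNReal.ofNat_ne_top
    (volume.restrict (Set.Icc (-R) R)) Measure.absolutelyContinuous_restrict).eventually_le_const
      (ENNReal.ofReal_pos.2 hε)).exists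
  refine ⟨f ∘ gridPoint n, isStepFunction_comp_gridPoint f n, ?_, fun _ => hbd _,
    fun _ => hτ _, hn⟩
  refine TVBoundedBy_of_eVariationOn_univ_le (by linarith) ?_
  calc eVariationOn (f ∘ gridPoint n) Set.univ
      ≤ eVariationOn f Set.univ := eVariationOn.comp_le_of_monotoneOn f _
        ((gridPoint_monotone n).monotoneOn _) (Set.mapsTo_univ _ _)
    _ ≤ ENNReal.ofReal V := h_var
    _ ≤ ENNReal.ofReal (2 * V) := ENNReal.ofReal_le_ofReal (by linarith)
end
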